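/- Let F be a type (of Gödel numbers of formulas), Bew : F → Prop a predicate ('is a deducible formula'), B : F → F → Prop a binary relation ('B y x: y is a deduction of the formula x'), neg : F → F a function (Gödel number of the negation of a formula), r : F → F a function, and g : F a distinguished element (the Gödel number of the formula (∀x)r(x)). Assume: (i) for every x, Bew(x) ↔ ∃ y, B(y, x); (ii) for every x, ¬B(x, g) → Bew(r(x)); (iii) for every x, B(x, g) → Bew(neg(r(x))); (iv) Bew(g) → ∀ y, Bew(r(y)); (v) for every x, ¬(Bew(x) ∧ Bew(neg(x))); (vi) the mathematical induction rule in the form (∀ x, Bew(r(x))) → Bew(g). Then a contradiction follows (False). -/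

import Mathlib

theorem stmt_8 {F : Type*} (Bew : F → Prop) (B : F → F → Prop)
    (neg : F → F) (r : F → F) (g : F)
    (h1 : ∀ x, Bew x ↔ ∃ y, B y x)
    (h2 : ∀ x, ¬ B x g → Bew (r x))
    (h3 : ∀ x, B x g → Bew (neg (r x)))
    (h4 : Bew g → ∀ y, Bew (r y))
    (h5 : ∀ x, ¬(Bew x ∧ Bew (neg x)))
    (h6 : (∀ x, Bew (r x)) → Bew g) :
    False := by
  have not_bew : ¬ Bew g := fun hg => by
    obtain ⟨y, hy⟩ := (h1 g).mp hg
    exact h5 (r y) ⟨h4 hg y, h3 y hy⟩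
  exact not_bew (h6 fun x => h2 x fun hx => not_bew ((h1 g).mpr ⟨x, hx⟩))
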